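/- Assume hypotheses (R1) and (L1), fix j ∈ {1,…,n−1}, and on the neighborhood of L where u_{nn̄} > 0 define S = (u_{nn̄})^{−2} |u_{jn̄n̄}|². Let q ∈ L be a point with S(q) > 0 (so that log S is defined and smooth near q). Then ∂²(log S)/∂z_j∂z̄_j evaluated at q equals 2 S(q). (Equivalently: where the pseudometric ψ^j = (i/2) S dz_j ∧ dz̄_j, the restriction of minus the Ricci form of the normal bundle metric to the j-th coordinate direction of the leaf, is nondegenerate, it satisfies Ric(ψ^j) = −2 ψ^j.) -/

import Mathlib

open Complex
open scoped ComplexOrder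

/-- Wirtinger derivative in direction `d.1`; `d.2 = true` means `∂/∂z̄`, `false` means `∂/∂z`. -/
noncomputable def wd {n : ℕ} (d : Fin n × Bool) (f : (Fin n → ℂ) → ℂ) : (Fin n → ℂ) → ℂ :=
  fun z => (1/2 : ℂ) * (fderiv ℝ f z (Pi.single d.1 1) +
      (if d.2 then Complex.I else -Complex.I) * fderiv ℝ f z (Pi.single d.1 Complex.I))

/-- Iterated Wirtinger derivative: differentiate in the listed directions, left to right. -/
noncomputable def wderiv {n : ℕ} (l : List (Fin n × Bool)) (f : (Fin n → ℂ) → ℂ) :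
    (Fin n → ℂ) → ℂ :=
  l.foldl (fun g d => wd d g) f

/-- The real function `u` viewed as a complex-valued function. -/
def cplx {n : ℕ} (u : (Fin n → ℂ) → ℝ) : (Fin n → ℂ) → ℂ := fun z => (u z : ℂ)

/-- Levi matrix entry `u_{jk̄} = ∂²u/∂z_j∂z̄_k`. -/
noncomputable def levi {n : ℕ} (u : (Fin n → ℂ) → ℝ) (j k : Fin n) : (Fin n → ℂ) → ℂ :=
  wderiv [(j, false), (k, true)] (cplx u)

section Helpers

variable {n : ℕ}

lemma wd_congr_nhds (d : Fin n × Bool) {f g : (Fin n → ℂ) → ℂ} {z : Fin n → ℂ}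
    (h : f =ᶠ[nhds z] g) : wd d f z = wd d g z := by
  simp only [wd, h.fderiv_eq]

lemma wd_congr_on (d : Fin n × Bool) {f g : (Fin n → ℂ) → ℂ} {U : Set (Fin n → ℂ)}
    (hU : IsOpen U) (h : Set.EqOn f g U) : Set.EqOn (wd d f) (wd d g) U := fun _ hz =>
  wd_congr_nhds d (h.eventuallyEq_of_mem (hU.mem_nhds hz))

lemma wd_smooth (d : Fin n × Bool) {f : (Fin n → ℂ) → ℂ} {U : Set (Fin n → ℂ)}
    (hU : IsOpen U) (hf : ContDiffOn ℝ (⊤ : ℕ∞) f U) : ContDiffOn ℝ (⊤ : ℕ∞) (wd d f) U := by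
  have h1 : ContDiffOn ℝ (⊤ : ℕ∞) (fderiv ℝ f) U := hf.fderiv_of_isOpen hU (by simp)
  unfold wd
  exact contDiffOn_const.mul ((h1.clm_apply contDiffOn_const).add
    (contDiffOn_const.mul (h1.clm_apply contDiffOn_const)))

lemma smooth_diffAt {E : Type*} [NormedAddCommGroup E] [NormedSpace ℝ E]
    {f : (Fin n → ℂ) → E} {U : Set (Fin n → ℂ)}
    (hU : IsOpen U) (hf : ContDiffOn ℝ (⊤ : ℕ∞) f U) {z : Fin n → ℂ} (hz : z ∈ U) :
    DifferentiableAt ℝ f z :=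
  (hf.contDiffAt (hU.mem_nhds hz)).differentiableAt (by simp)

lemma wd_mul (d : Fin n × Bool) {f g : (Fin n → ℂ) → ℂ} {z : Fin n → ℂ}
    (hf : DifferentiableAt ℝ f z) (hg : DifferentiableAt ℝ g z) :
    wd d (fun w => f w * g w) z = wd d f z * g z + f z * wd d g z := by
  simp only [wd, fderiv_fun_mul hf hg]
  rcases d with ⟨i, _ | _⟩ <;> simp <;> ring

lemma wd_add (d : Fin n × Bool) {f g : (Fin n → ℂ) → ℂ} {z : Fin n → ℂ}
    (hf : DifferentiableAt ℝ f z) (hg : DifferentiableAt ℝ g z) :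
    wd d (fun w => f w + g w) z = wd d f z + wd d g z := by
  simp only [wd, fderiv_fun_add hf hg]
  rcases d with ⟨i, _ | _⟩ <;> simp <;> ring

lemma wd_sub (d : Fin n × Bool) {f g : (Fin n → ℂ) → ℂ} {z : Fin n → ℂ}
    (hf : DifferentiableAt ℝ f z) (hg : DifferentiableAt ℝ g z) :
    wd d (fun w => f w - g w) z = wd d f z - wd d g z := by
  simp only [wd, fderiv_fun_sub hf hg]
  rcases d with ⟨i, _ | _⟩ <;> simp <;> ring

lemma wd_comp (d : Fin n × Bool) {f : (Fin n → ℂ) → ℂ} {z : Fin n → ℂ} {φ : ℂ → ℂ} {c : ℂ}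
    (hf : DifferentiableAt ℝ f z) (hφ : HasDerivAt φ c (f z)) :
    wd d (fun w => φ (f w)) z = c * wd d f z := by
  have h := (hφ.hasFDerivAt.restrictScalars ℝ).comp z hf.hasFDerivAt
  have h' : fderiv ℝ (fun w => φ (f w)) z = _ := h.fderiv
  simp only [wd, h']
  rcases d with ⟨i, _ | _⟩ <;> simp <;> ring

lemma wd_conj (i : Fin n) (b : Bool) {f : (Fin n → ℂ) → ℂ} {z : Fin n → ℂ}
    (hf : DifferentiableAt ℝ f z) :
    (starRingEnd ℂ) (wd (i, b) f z) = wd (i, !b) (fun w => (starRingEnd ℂ) (f w)) z := by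
  have h := (Complex.conjCLE.toContinuousLinearMap.hasFDerivAt (x := f z)).comp z hf.hasFDerivAt
  have h' : fderiv ℝ (fun w => (starRingEnd ℂ) (f w)) z = _ := h.fderiv
  simp only [wd, h']
  have h2 : (starRingEnd ℂ) (2 : ℂ) = 2 := Complex.conj_ofNat 2
  cases b <;> simp [h2]

lemma wd_comm (d e : Fin n × Bool) {f : (Fin n → ℂ) → ℂ} {U : Set (Fin n → ℂ)}
    (hU : IsOpen U) (hf : ContDiffOn ℝ (⊤ : ℕ∞) f U) :
    Set.EqOn (wd d (wd e f)) (wd e (wd d f)) U := by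
  intro z hz
  have h1 : DifferentiableAt ℝ (fderiv ℝ f) z :=
    smooth_diffAt hU (hf.fderiv_of_isOpen hU (by simp)) hz
  have hs : IsSymmSndFDerivAt ℝ f z :=
    (hf.contDiffAt (hU.mem_nhds hz)).isSymmSndFDerivAt (by
      simp only [minSmoothness_of_isRCLikeNormedField]
      exact WithTop.coe_le_coe.mpr le_top)
  have key : ∀ (e : Fin n × Bool) (v : Fin n → ℂ), fderiv ℝ (wd e f) z v =
      (1/2 : ℂ) * (fderiv ℝ (fderiv ℝ f) z v (Pi.single e.1 1) +
      (if e.2 then Complex.I else -Complex.I) *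
        fderiv ℝ (fderiv ℝ f) z v (Pi.single e.1 Complex.I)) := by
    intro e v
    have h2 : ∀ w : Fin n → ℂ, HasFDerivAt (fun y => fderiv ℝ f y w)
        ((fderiv ℝ (fderiv ℝ f) z).flip w) z := fun w => by
      have := h1.hasFDerivAt.clm_apply (hasFDerivAt_const w z)
      simpa using this
    have h3 := ((h2 (Pi.single e.1 1)).add ((h2 (Pi.single e.1 Complex.I)).const_mul
      (if e.2 then Complex.I else -Complex.I))).const_mul (1/2 : ℂ)
    have h4 : fderiv ℝ (wd e f) z = _ := h3.fderiv
    rw [h4]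
    rcases e with ⟨i, _ | _⟩ <;> simp <;> ring
  rw [wd, wd]
  simp only [key]
  rw [hs.eq (Pi.single d.1 1) (Pi.single e.1 1), hs.eq (Pi.single d.1 1) (Pi.single e.1 I),
    hs.eq (Pi.single d.1 I) (Pi.single e.1 1), hs.eq (Pi.single d.1 I) (Pi.single e.1 I)]
  ring

lemma wd_tangent (i k : Fin n) (hik : i ≠ k) (b : Bool) {f : (Fin n → ℂ) → ℂ}
    {U : Set (Fin n → ℂ)} (hU : IsOpen U) {z : Fin n → ℂ} (hz : z ∈ U) (hzk : z k = 0)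
    (hf : DifferentiableAt ℝ f z) (h0 : ∀ w ∈ U, w k = 0 → f w = 0) : wd (i, b) f z = 0 := by
  have key : ∀ c : ℂ, fderiv ℝ f z (Pi.single i c) = 0 := by
    intro c
    have h1 : HasLineDerivAt ℝ f (fderiv ℝ f z (Pi.single i c)) z (Pi.single i c) :=
      hf.hasFDerivAt.hasLineDerivAt _
    have h2 : (fun t : ℝ => f (z + t • (Pi.single i c : Fin n → ℂ))) =ᶠ[nhds 0] fun _ => 0 := by
      have hc : Filter.Tendsto (fun t : ℝ => z + t • (Pi.single i c : Fin n → ℂ)) (nhds 0)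
          (nhds z) := by
        have : Continuous (fun t : ℝ => z + t • (Pi.single i c : Fin n → ℂ)) := by fun_prop
        simpa using this.tendsto 0
      filter_upwards [hc (hU.mem_nhds hz)] with t ht
      exact h0 _ ht (by simp [hzk, Pi.single_eq_of_ne hik.symm])
    exact (HasDerivAt.unique h1 ((hasDerivAt_const (0:ℝ) (0:ℂ)).congr_of_eventuallyEq h2))
  simp [wd, key]

end Helpers

/-- The pointwise algebra behind the curvature computation. -/
lemma final_algebra (S Sp Sq Spq g gp gq gpq A Ap Aq Apq B Bp Bq Bpq : ℂ)
    (hS : S ≠ 0) (hg : g ≠ 0)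
    (e0 : S * (g * g) = A * B)
    (e1 : Sp * (g * g) + S * (gp * g + g * gp) = Ap * B + A * Bp)
    (e2 : Sq * (g * g) + S * (gq * g + g * gq) = Aq * B + A * Bq)
    (e3 : Spq * (g * g) + Sp * (gq * g + g * gq) + (Sq * (gp * g + g * gp)
      + S * (gpq * g + gp * gq + (gq * gp + g * gpq)))
      = Apq * B + Ap * Bq + (Aq * Bp + A * Bpq))
    (a1 : Aq * g = 2 * A * gq) (b1 : Bp * g = 2 * B * gp)
    (a2 : Apq * g + Aq * gp = 2 * (Ap * gq + A * gpq))
    (b2 : Bpq * g + Bp * gq = 2 * (Bq * gp + B * gpq))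
    (h : gpq * g = gp * gq + A * B) :
    (-(S ^ 2)⁻¹ * Sq) * Sp + S⁻¹ * Spq = 2 * S := by
  have hAB : A * B ≠ 0 := by rw [← e0]; exact mul_ne_zero hS (mul_ne_zero hg hg)
  have hA : A ≠ 0 := left_ne_zero_of_mul hAB
  have hB : B ≠ 0 := right_ne_zero_of_mul hAB
  obtain rfl : S = A * B / g ^ 2 := by field_simp; linear_combination e0
  obtain rfl : gpq = (gp * gq + A * B) / g := by field_simp; linear_combination h
  obtain rfl : Aq = 2 * A * gq / g := by field_simp; linear_combination a1
  obtain rfl : Bp = 2 * B * gp / g := by field_simp; linear_combination b1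
  obtain rfl : Apq = (2 * (Ap * gq + A * ((gp * gq + A * B) / g)) - 2 * A * gq / g * gp) / g := by
    rw [eq_div_iff hg]; linear_combination a2
  obtain rfl : Bpq = (2 * (Bq * gp + B * ((gp * gq + A * B) / g)) - 2 * B * gp / g * gq) / g := by
    rw [eq_div_iff hg]; linear_combination b2
  obtain rfl : Sp = (Ap * B + A * (2 * B * gp / g) - A * B / g ^ 2 * (gp * g + g * gp)) / g ^ 2 := by
    rw [eq_div_iff (pow_ne_zero 2 hg)]; linear_combination e1
  obtain rfl : Sq = (2 * A * gq / g * B + A * Bq - A * B / g ^ 2 * (gq * g + g * gq)) / g ^ 2 := by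
    rw [eq_div_iff (pow_ne_zero 2 hg)]; linear_combination e2
  field_simp at e3 ⊢
  have : Spq * g ^ 4 = Ap * Bq * g ^ 2 + 2 * A ^ 2 * B ^ 2 := by
    have hg2 : g ^ 2 ≠ 0 := pow_ne_zero 2 hg
    linear_combination e3
  linear_combination this

/-- under (R1) and (L1), with S = (u_{nn̄})⁻² u_{n̄jn̄} u_{nj̄n}
(a real-valued function near L), at any point q of the leaf L = {z_n = 0} where S(q) > 0
one has [log S]_{jj̄}(q) = 2 S(q), i.e. Ric(ψʲ) = -2 ψʲ where nondegenerate. -/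
theorem stmt_9 {m : ℕ} (hm : 1 ≤ m) (U : Set (Fin (m+1) → ℂ)) (hU : IsOpen U)
    (u : (Fin (m+1) → ℂ) → ℝ) (hsmooth : ContDiffOn ℝ (⊤ : ℕ∞) u U)
    (hR1 : ∀ z ∈ U, ∀ j k : Fin (m+1), j ≠ Fin.last m → k ≠ Fin.last m →
      levi u j k z * levi u (Fin.last m) (Fin.last m) z
        - levi u j (Fin.last m) z * levi u (Fin.last m) k z = 0)
    (hL1 : ∀ z ∈ U, z (Fin.last m) = 0 →
      (∀ j k : Fin (m+1), (j, k) ≠ (Fin.last m, Fin.last m) → levi u j k z = 0) ∧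
      0 < (levi u (Fin.last m) (Fin.last m) z).re ∧
      (levi u (Fin.last m) (Fin.last m) z).im = 0)
    (j : Fin (m+1)) (hj : j ≠ Fin.last m)
    (q : Fin (m+1) → ℂ) (hqU : q ∈ U) (hqL : q (Fin.last m) = 0)
    (hSpos : 0 < ((((levi u (Fin.last m) (Fin.last m) q)⁻¹) ^ 2
      * wderiv [(Fin.last m, true), (j, false), (Fin.last m, true)] (cplx u) q
      * wderiv [(Fin.last m, false), (j, true), (Fin.last m, false)] (cplx u) q).re)) :
    wderiv [(j, false), (j, true)]
        (fun w => (Real.log ((((levi u (Fin.last m) (Fin.last m) w)⁻¹) ^ 2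
          * wderiv [(Fin.last m, true), (j, false), (Fin.last m, true)] (cplx u) w
          * wderiv [(Fin.last m, false), (j, true), (Fin.last m, false)] (cplx u) w).re) : ℂ)) q
      = 2 * (((((levi u (Fin.last m) (Fin.last m) q)⁻¹) ^ 2
          * wderiv [(Fin.last m, true), (j, false), (Fin.last m, true)] (cplx u) q
          * wderiv [(Fin.last m, false), (j, true), (Fin.last m, false)] (cplx u) q).re) : ℝ) := by
  set N : Fin (m+1) := Fin.last m with hN
  have hu0 : ContDiffOn ℝ (⊤ : ℕ∞) (cplx u) U :=
    Complex.ofRealCLM.contDiff.comp_contDiffOn hsmooth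
  have sm : ∀ (d : Fin (m+1) × Bool) {f : (Fin (m+1) → ℂ) → ℂ},
      ContDiffOn ℝ (⊤ : ℕ∞) f U → ContDiffOn ℝ (⊤ : ℕ∞) (wd d f) U := fun d _ h => wd_smooth d hU h
  have da : ∀ {f : (Fin (m+1) → ℂ) → ℂ}, ContDiffOn ℝ (⊤ : ℕ∞) f U → ∀ {z}, z ∈ U →
      DifferentiableAt ℝ f z := fun h _ hz => smooth_diffAt hU h hz
  have cg : ∀ (d : Fin (m+1) × Bool) {f g : (Fin (m+1) → ℂ) → ℂ}, Set.EqOn f g U →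
      Set.EqOn (wd d f) (wd d g) U := fun d _ _ h => wd_congr_on d hU h
  have cm : ∀ (d e : Fin (m+1) × Bool) {f : (Fin (m+1) → ℂ) → ℂ},
      ContDiffOn ℝ (⊤ : ℕ∞) f U → Set.EqOn (wd d (wd e f)) (wd e (wd d f)) U :=
    fun d e _ h => wd_comm d e hU h
  -- names for the relevant functions
  obtain ⟨v, hv⟩ : ∃ v, v = cplx u := ⟨_, rfl⟩
  obtain ⟨g, hgd⟩ : ∃ g, g = wd (N, true) (wd (N, false) v) := ⟨_, rfl⟩
  obtain ⟨a, had⟩ : ∃ a, a = wd (N, true) (wd (j, false) v) := ⟨_, rfl⟩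
  obtain ⟨b, hbd⟩ : ∃ b, b = wd (j, true) (wd (N, false) v) := ⟨_, rfl⟩
  obtain ⟨h, hhd⟩ : ∃ h, h = wd (j, true) (wd (j, false) v) := ⟨_, rfl⟩
  obtain ⟨A, hAd⟩ : ∃ A, A = wd (N, true) (wd (j, false) (wd (N, true) v)) := ⟨_, rfl⟩
  obtain ⟨B, hBd⟩ : ∃ B, B = wd (N, false) (wd (j, true) (wd (N, false) v)) := ⟨_, rfl⟩
  rw [← hv] at hu0
  have eg : levi u N N = g := by rw [hgd, hv]; rfl
  have ea : levi u j N = a := by rw [had, hv]; rfl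
  have eb : levi u N j = b := by rw [hbd, hv]; rfl
  have eh : levi u j j = h := by rw [hhd, hv]; rfl
  have eA : wderiv [(N, true), (j, false), (N, true)] (cplx u) = A := by rw [hAd, hv]; rfl
  have eB : wderiv [(N, false), (j, true), (N, false)] (cplx u) = B := by rw [hBd, hv]; rfl
  have rel : ∀ z ∈ U, h z * g z = a z * b z := by
    intro z hz
    have := hR1 z hz j j hj hj
    rw [eh, eg, ea, eb] at this
    exact sub_eq_zero.mp this
  have onL : ∀ z ∈ U, z N = 0 → h z = 0 ∧ a z = 0 ∧ b z = 0 ∧ g z ≠ 0 := by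
    intro z hz hzN
    obtain ⟨h1, h2, -⟩ := hL1 z hz hzN
    refine ⟨?_, ?_, ?_, ?_⟩
    · rw [← eh]; exact h1 _ _ (by simp [hj])
    · rw [← ea]; exact h1 _ _ (by simp [hj])
    · rw [← eb]; exact h1 _ _ (by simp [hj])
    · intro h0; rw [eg, h0] at h2; simp at h2
  rw [eg, eA, eB] at hSpos
  rw [eg, eA, eB]
  have sg : ContDiffOn ℝ (⊤ : ℕ∞) g U := by rw [hgd]; exact sm _ (sm _ hu0)
  have sa : ContDiffOn ℝ (⊤ : ℕ∞) a U := by rw [had]; exact sm _ (sm _ hu0)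
  have sb : ContDiffOn ℝ (⊤ : ℕ∞) b U := by rw [hbd]; exact sm _ (sm _ hu0)
  have sh : ContDiffOn ℝ (⊤ : ℕ∞) h U := by rw [hhd]; exact sm _ (sm _ hu0)
  have sA : ContDiffOn ℝ (⊤ : ℕ∞) A U := by rw [hAd]; exact sm _ (sm _ (sm _ hu0))
  have sB : ContDiffOn ℝ (⊤ : ℕ∞) B U := by rw [hBd]; exact sm _ (sm _ (sm _ hu0))
  -- commutation identities
  have c_an' : Set.EqOn (wd (N, true) a) A U := by
    rw [had, hAd]; exact cg _ (cm _ _ hu0)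
  have c_bn : Set.EqOn (wd (N, false) b) B U := by rw [hbd, hBd]; exact fun _ _ => rfl
  have c_bn' : Set.EqOn (wd (N, true) b) (wd (j, true) g) U := by
    rw [hbd, hgd]; exact cm _ _ (sm _ hu0)
  have c_an : Set.EqOn (wd (N, false) a) (wd (j, false) g) U := by
    rw [had, hgd]
    exact ((cm _ _ (sm _ hu0)).trans (cg _ (cm _ _ hu0))).trans (cm _ _ (sm _ hu0))
  have c_hn' : Set.EqOn (wd (N, true) h) (wd (j, true) a) U := by
    rw [had, hhd]; exact cm _ _ (sm _ hu0)
  have c_hn : Set.EqOn (wd (N, false) h) (wd (j, false) b) U := by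
    rw [hbd, hhd]
    exact ((cm _ _ (sm _ hu0)).trans (cg _ (cm _ _ hu0))).trans (cm _ _ (sm _ hu0))
  have c_hn'n' : Set.EqOn (wd (N, true) (wd (N, true) h)) (wd (j, true) A) U :=
    ((cg _ c_hn').trans (cm _ _ sa)).trans (cg _ c_an')
  have c_hnn : Set.EqOn (wd (N, false) (wd (N, false) h)) (wd (j, false) B) U :=
    ((cg _ c_hn).trans (cm _ _ sb)).trans (cg _ c_bn)
  have c_hnn' : Set.EqOn (wd (N, true) (wd (N, false) h)) (wd (j, true) (wd (j, false) g)) U :=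
    ((cg _ c_hn).trans (cm _ _ sb)).trans ((cg _ c_bn').trans (cm _ _ sg))
  -- first and second derivatives of the relation `h g = a b`
  have r1 : ∀ d : Fin (m+1) × Bool, Set.EqOn (fun z => wd d h z * g z + h z * wd d g z)
      (fun z => wd d a z * b z + a z * wd d b z) U := by
    intro d z hz
    have := cg d (f := fun w => h w * g w) (g := fun w => a w * b w) rel hz
    rwa [wd_mul d (da sh hz) (da sg hz), wd_mul d (da sa hz) (da sb hz)] at this
  have r2 : ∀ d e : Fin (m+1) × Bool, ∀ z ∈ U,
      wd e (wd d h) z * g z + wd d h z * wd e g z + (wd e h z * wd d g z + h z * wd e (wd d g) z)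
      = wd e (wd d a) z * b z + wd d a z * wd e b z
        + (wd e a z * wd d b z + a z * wd e (wd d b) z) := by
    intro d e z hz
    have := cg e (r1 d) hz
    rwa [wd_add e (((da (sm d sh) hz)).fun_mul (da sg hz)) ((da sh hz).fun_mul (da (sm d sg) hz)),
      wd_add e (((da (sm d sa) hz)).fun_mul (da sb hz)) ((da sa hz).fun_mul (da (sm d sb) hz)),
      wd_mul e (da (sm d sh) hz) (da sg hz), wd_mul e (da sh hz) (da (sm d sg) hz),
      wd_mul e (da (sm d sa) hz) (da sb hz), wd_mul e (da sa hz) (da (sm d sb) hz)] at this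
  have hd0 : ∀ d, ∀ z ∈ U, z N = 0 → wd d h z = 0 := by
    intro d z hz hzN
    obtain ⟨h1, h2, h3, h4⟩ := onL z hz hzN
    have := r1 d hz
    simp only [h1, h2, h3, zero_mul, mul_zero, add_zero] at this
    exact (mul_eq_zero.mp this).resolve_right h4
  have r3 : ∀ d e : Fin (m+1) × Bool, ∀ z ∈ U, z N = 0 →
      wd e (wd d h) z * g z = wd d a z * wd e b z + wd e a z * wd d b z := by
    intro d e z hz hzN
    obtain ⟨h1, h2, h3, h4⟩ := onL z hz hzN
    have := r2 d e z hz
    rw [hd0 d z hz hzN, hd0 e z hz hzN, h1, h2, h3] at this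
    linear_combination this
  have lA : ∀ z ∈ U, z N = 0 → wd (j, true) A z * g z = 2 * A z * wd (j, true) g z := by
    intro z hz hzN
    have := r3 (N, true) (N, true) z hz hzN
    rw [c_hn'n' hz, c_an' hz, c_bn' hz] at this
    linear_combination this
  have lB : ∀ z ∈ U, z N = 0 → wd (j, false) B z * g z = 2 * B z * wd (j, false) g z := by
    intro z hz hzN
    have := r3 (N, false) (N, false) z hz hzN
    rw [c_hnn hz, c_an hz, c_bn hz] at this
    linear_combination this
  have lg : ∀ z ∈ U, z N = 0 → wd (j, true) (wd (j, false) g) z * g z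
      = wd (j, false) g z * wd (j, true) g z + A z * B z := by
    intro z hz hzN
    have := r3 (N, false) (N, true) z hz hzN
    rw [c_hnn' hz, c_an hz, c_bn hz, c_an' hz, c_bn' hz] at this
    linear_combination this
  -- tangential derivatives
  have tang : ∀ (c c' : Bool) (F : (Fin (m+1) → ℂ) → ℂ), ContDiffOn ℝ (⊤ : ℕ∞) F U →
      (∀ z ∈ U, z N = 0 → wd (j, c) F z * g z = 2 * F z * wd (j, c) g z) →
      wd (j, c') (wd (j, c) F) q * g q + wd (j, c) F q * wd (j, c') g q
        = 2 * (wd (j, c') F q * wd (j, c) g q + F q * wd (j, c') (wd (j, c) g) q) := by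
    intro c c' F sF hF
    have d1 := (da (sm (j, c) sF) hqU).fun_mul (da sg hqU)
    have d2 := (da sF hqU).fun_mul (da (sm (j, c) sg) hqU)
    have d3 := (differentiableAt_const (2:ℂ) (x := q) (𝕜 := ℝ)).fun_mul d2
    have := wd_tangent j N hj c' (f := fun z => wd (j, c) F z * g z
      - 2 * (F z * wd (j, c) g z)) hU hqU hqL (d1.fun_sub d3) (by
        intro w hw hwN
        rw [hF w hw hwN]; ring)
    rw [wd_sub _ d1 d3, wd_mul _ (da (sm (j, c) sF) hqU) (da sg hqU),
      wd_comp (f := fun z => F z * wd (j, c) g z) (φ := fun x => 2 * x) (c := 2) _ d2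
        (by simpa using (hasDerivAt_id _).const_mul (2:ℂ)),
      wd_mul _ (da sF hqU) (da (sm (j, c) sg) hqU)] at this
    linear_combination this
  have tA := tang true false A sA lA
  have tB := tang false true B sB lB
  rw [cm (j, false) (j, true) sA hqU, cm (j, false) (j, true) sg hqU] at tA
  -- reality
  have cjv : (fun w => (starRingEnd ℂ) (v w)) = v := by
    funext w; rw [hv]; exact Complex.conj_ofReal _
  have cj1 : ∀ (i : Fin (m+1)) (c : Bool),
      Set.EqOn (fun z => (starRingEnd ℂ) (wd (i, c) v z)) (wd (i, !c) v) U := by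
    intro i c z hz
    have := wd_conj i c (da hu0 hz)
    rwa [cjv] at this
  have cjs : ∀ (i : Fin (m+1)) (c : Bool) (F G : (Fin (m+1) → ℂ) → ℂ),
      ContDiffOn ℝ (⊤ : ℕ∞) F U → Set.EqOn (fun z => (starRingEnd ℂ) (F z)) G U →
      Set.EqOn (fun z => (starRingEnd ℂ) (wd (i, c) F z)) (wd (i, !c) G) U := by
    intro i c F G sF hFG z hz
    exact (wd_conj i c (da sF hz)).trans (cg _ hFG hz)
  have cjg : ∀ z ∈ U, (starRingEnd ℂ) (g z) = g z := by
    intro z hz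
    have h1 := cjs N true _ _ (sm _ hu0) (cj1 N false) hz
    have h2 := cm (N, false) (N, true) hu0 hz
    rw [hgd]
    exact h1.trans h2
  have cjA : ∀ z ∈ U, (starRingEnd ℂ) (A z) = B z := by
    intro z hz
    have h1 := cjs N true _ _ (sm _ (sm _ hu0)) (cjs j false _ _ (sm _ hu0) (cj1 N true)) hz
    rw [hAd, hBd]
    exact h1
  have cjB : ∀ z ∈ U, (starRingEnd ℂ) (B z) = A z := by
    intro z hz
    rw [← cjA z hz, Complex.conj_conj]
  -- the function S and its domain
  obtain ⟨S, hSd⟩ : ∃ S : (Fin (m+1) → ℂ) → ℂ, S = fun w => ((g w)⁻¹) ^ 2 * A w * B w := ⟨_, rfl⟩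
  have hSw : ∀ w, ((g w)⁻¹) ^ 2 * A w * B w = S w := fun w => by rw [hSd]
  simp only [hSw] at hSpos ⊢
  have Sre : ∀ z ∈ U, ((S z).re : ℂ) = S z := by
    intro z hz
    apply Complex.conj_eq_iff_re.mp
    rw [← hSw]
    simp only [map_mul, map_pow, map_inv₀, cjg z hz, cjA z hz, cjB z hz]
    ring
  have gq : g q ≠ 0 := (onL q hqU hqL).2.2.2
  have V1o : IsOpen (U ∩ g ⁻¹' {0}ᶜ) :=
    sg.continuousOn.isOpen_inter_preimage hU isOpen_compl_singleton
  have sS1 : ContDiffOn ℝ (⊤ : ℕ∞) S (U ∩ g ⁻¹' {0}ᶜ) := by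
    rw [hSd]
    exact ((((sg.mono Set.inter_subset_left).inv (fun z hz => hz.2)).pow 2).mul
      (sA.mono Set.inter_subset_left)).mul (sB.mono Set.inter_subset_left)
  obtain ⟨V, hVd⟩ : ∃ V, V = (U ∩ g ⁻¹' {0}ᶜ) ∩ S ⁻¹' {x | 0 < x.re} := ⟨_, rfl⟩
  have Vo : IsOpen V := by
    rw [hVd]
    exact sS1.continuousOn.isOpen_inter_preimage V1o
      (isOpen_lt continuous_const Complex.continuous_re)
  have hqV : q ∈ V := by rw [hVd]; exact ⟨⟨hqU, gq⟩, hSpos⟩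
  have VU : V ⊆ U := by rw [hVd]; exact fun z hz => hz.1.1
  have Vg : ∀ z ∈ V, g z ≠ 0 := by rw [hVd]; exact fun z hz => hz.1.2
  have VS : ∀ z ∈ V, 0 < (S z).re := by rw [hVd]; exact fun z hz => hz.2
  have VS0 : ∀ z ∈ V, S z ≠ 0 := fun z hz h0 => by
    have := VS z hz
    rw [h0] at this; simp at this
  have sS : ContDiffOn ℝ (⊤ : ℕ∞) S V := sS1.mono (by rw [hVd]; exact Set.inter_subset_left)
  have dS : ∀ z ∈ V, DifferentiableAt ℝ S z := fun z hz => smooth_diffAt Vo sS hz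
  have dSd : ∀ d, ∀ z ∈ V, DifferentiableAt ℝ (wd d S) z := fun d z hz =>
    smooth_diffAt Vo (wd_smooth d Vo sS) hz
  -- derivatives of log S
  have hlog : Set.EqOn (fun w => ((Real.log (S w).re : ℝ) : ℂ)) (fun w => Complex.log (S w)) V := by
    intro w hw
    have := Complex.ofReal_log (VS w hw).le
    rw [Sre w (VU hw)] at this
    exact this
  have hlog1 : Set.EqOn (wd (j, false) (fun w => ((Real.log (S w).re : ℝ) : ℂ)))
      (fun w => (S w)⁻¹ * wd (j, false) S w) V := by
    intro w hw
    rw [wd_congr_on _ Vo hlog hw]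
    exact wd_comp _ (dS w hw) (Complex.hasDerivAt_log (Or.inl (VS w hw)))
  have hlog2 : wd (j, true) (wd (j, false) (fun w => ((Real.log (S w).re : ℝ) : ℂ))) q
      = (-(S q ^ 2)⁻¹ * wd (j, true) S q) * wd (j, false) S q
        + (S q)⁻¹ * wd (j, true) (wd (j, false) S) q := by
    rw [wd_congr_on _ Vo hlog1 hqV,
      wd_mul _ ((dS q hqV).fun_inv (VS0 q hqV)) (dSd _ q hqV),
      wd_comp _ (φ := fun x => x⁻¹) (dS q hqV) (hasDerivAt_inv (VS0 q hqV))]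
  -- derivatives of S g^2 = A B
  have s0 : Set.EqOn (fun z => S z * (g z * g z)) (fun z => A z * B z) V := by
    intro z hz
    have := Vg z hz
    simp only [← hSw]
    field_simp
  have s1 : ∀ d, Set.EqOn
      (fun z => wd d S z * (g z * g z) + S z * (wd d g z * g z + g z * wd d g z))
      (fun z => wd d A z * B z + A z * wd d B z) V := by
    intro d z hz
    have hz' := VU hz
    have := wd_congr_on d Vo s0 hz
    rwa [wd_mul d (dS z hz) ((da sg hz').fun_mul (da sg hz')), wd_mul d (da sg hz') (da sg hz'),
      wd_mul d (da sA hz') (da sB hz')] at this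
  have s2 := wd_congr_on (j, true) Vo (s1 (j, false)) hqV
  have dg := da sg hqU
  have dgp := da (sm (j, false) sg) hqU
  have dgg := dg.fun_mul dg
  have dA := da sA hqU
  have dB := da sB hqU
  have dAp := da (sm (j, false) sA) hqU
  have dBp := da (sm (j, false) sB) hqU
  have dk := (dgp.fun_mul dg).fun_add (dg.fun_mul dgp)
  rw [wd_add _ ((dSd _ q hqV).fun_mul dgg) ((dS q hqV).fun_mul dk),
    wd_mul _ (dSd _ q hqV) dgg, wd_mul _ dg dg, wd_mul _ (dS q hqV) dk,
    wd_add _ (dgp.fun_mul dg) (dg.fun_mul dgp), wd_mul _ dgp dg, wd_mul _ dg dgp,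
    wd_add _ (dAp.fun_mul dB) (dA.fun_mul dBp), wd_mul _ dAp dB, wd_mul _ dA dBp] at s2
  have fin := final_algebra (S q) _ _ _ (g q) _ _ _ (A q) _ _ _ (B q) _ _ _ (VS0 q hqV) gq
    (s0 hqV) (s1 (j, false) hqV) (s1 (j, true) hqV) s2 (lA q hqU hqL) (lB q hqU hqL) tA tB
    (lg q hqU hqL)
  change wd (j, true) (wd (j, false) (fun w => ((Real.log (S w).re : ℝ) : ℂ))) q = _
  rw [hlog2, fin, Sre q hqU]
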